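/- arXiv:math/0607709 — 5 statements merged into one kernel-verified Lean document; each statement's English description precedes it below -/
import Mathlib

section
/- Let μ > 0, ε > 0 and for α ∈ {1,2,3} let R_α ∈ Mat_{9×3}(ℝ) be the block-column matrix whose β-th 3×3 block (β = 1,2,3) is δ_{βα} I_{3×3}. Let A^ε_α ∈ Mat_{21×21}(ℝ) be the block matrix (with block sizes 9, 3, 9) with first block row (0_{9×9}, −R_α, 0_{9×9}), second block row (0_{3×9}, 0_{3×3}, −R_α^T), third block row (0_{9×9}, −(μ/ε) R_α, 0_{9×9}), and let B^ε ∈ Mat_{21×21}(ℝ) have block rows ((μ/ε) I_{9×9}, 0_{9×3}, −I_{9×9}), (0_{3×9}, (μ/ε − 1) I_{3×3}, 0_{3×9}), (−I_{9×9}, 0_{9×3}, I_{9×9}). Then B^ε is symmetric and, for each α, the product B^ε A^ε_α is the symmetric matrix with block rows (0_{9×9}, 0_{9×3}, 0_{9×9}), (0_{3×9}, 0_{3×3}, −(μ/ε − 1) R_α^T), (0_{9×9}, −(μ/ε − 1) R_α, 0_{9×9}); in particular B^ε symmetrizes the constant-coefficient hyperbolic operator ∂_t + Σ_α A^ε_α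 ∂_α. -/
open Matrix

/-!
STATEMENT 0: the matrix `B^ε` is symmetric and symmetrizes the constant-coefficient
hyperbolic operator `∂_t + Σ_α A^ε_α ∂_α` of the relaxation system of viscoelasticity:
each product `B^ε A^ε_α` equals the explicitly given symmetric matrix.

The state space ℝ²¹ = ℝ⁹ ⊕ ℝ³ ⊕ ℝ⁹ is indexed by `(Fin 3 × Fin 3) ⊕ (Fin 3 ⊕ (Fin 3 × Fin 3))`,
where a pair `(β, j) : Fin 3 × Fin 3` indexes the `j`-th row of the `β`-th `3×3` block of ℝ⁹.
-/

/-- Index type for ℝ⁹ ≅ Mat_{3×3}(ℝ): `(β, j)` is the `j`-th entry of the `β`-th 3×3 block. -/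
abbrev Idx9 := Fin 3 × Fin 3

/-- Index type for ℝ²¹ = ℝ⁹ ⊕ ℝ³ ⊕ ℝ⁹, on which the vectors `W = (F, v, S)` live. -/
abbrev Idx21 := Idx9 ⊕ (Fin 3 ⊕ Idx9)

/-- `R_α ∈ Mat_{9×3}(ℝ)`: the block-column matrix whose `β`-th `3×3` block is `δ_{βα} I₃`. -/
def Rmat (α : Fin 3) : Matrix Idx9 (Fin 3) ℝ :=
  fun p i => if p.1 = α ∧ p.2 = i then 1 else 0

/-- `A^ε_α ∈ Mat_{21×21}(ℝ)`, with block rows `(0, -R_α, 0)`, `(0, 0, -R_αᵀ)`,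
`(0, -(μ/ε) R_α, 0)`. -/
noncomputable def Amat (μ ε : ℝ) (α : Fin 3) : Matrix Idx21 Idx21 ℝ :=
  fun x y =>
    match x, y with
    | .inl p, .inr (.inl i) => -(Rmat α p i)
    | .inr (.inl i), .inr (.inr p) => -((Rmat α)ᵀ i p)
    | .inr (.inr p), .inr (.inl i) => -(μ / ε) * Rmat α p i
    | _, _ => 0

/-- The symmetrizer `B^ε ∈ Mat_{21×21}(ℝ)`, with block rows `((μ/ε) I₉, 0, -I₉)`,
`(0, (μ/ε - 1) I₃, 0)`, `(-I₉, 0, I₉)`. -/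
noncomputable def Bmat (μ ε : ℝ) : Matrix Idx21 Idx21 ℝ :=
  fun x y =>
    match x, y with
    | .inl p, .inl q => if p = q then μ / ε else 0
    | .inl p, .inr (.inr q) => if p = q then -1 else 0
    | .inr (.inl i), .inr (.inl j) => if i = j then μ / ε - 1 else 0
    | .inr (.inr p), .inl q => if p = q then -1 else 0
    | .inr (.inr p), .inr (.inr q) => if p = q then 1 else 0
    | _, _ => 0

/-- The claimed value of the product `B^ε A^ε_α`: block rows `(0, 0, 0)`,
`(0, 0, -(μ/ε - 1) R_αᵀ)`, `(0, -(μ/ε - 1) R_α, 0)`. -/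
noncomputable def Cmat (μ ε : ℝ) (α : Fin 3) : Matrix Idx21 Idx21 ℝ :=
  fun x y =>
    match x, y with
    | .inr (.inl i), .inr (.inr p) => -(μ / ε - 1) * (Rmat α)ᵀ i p
    | .inr (.inr p), .inr (.inl i) => -(μ / ε - 1) * Rmat α p i
    | _, _ => 0

/-- For `μ, ε > 0`, the matrix `B^ε` is symmetric and, for each
`α = 1, 2, 3`, the product `B^ε A^ε_α` equals the symmetric matrix `Cmat μ ε α`;
in particular `B^ε` symmetrizes the operator `∂_t + Σ_α A^ε_α ∂_α`. -/
theorem stmt0 (μ ε : ℝ) (hμ : 0 < μ) (hε : 0 < ε) :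
    (Bmat μ ε).IsSymm ∧
      ∀ α : Fin 3, Bmat μ ε * Amat μ ε α = Cmat μ ε α ∧ (Cmat μ ε α).IsSymm := by
  refine ⟨IsSymm.ext ?_, fun α => ⟨?_, IsSymm.ext ?_⟩⟩
  · rintro (p | i | p) (q | j | q) <;> simp [Bmat, eq_comm]
  · ext (p | i | p) (q | j | q) <;>
      simp [Matrix.mul_apply, Fintype.sum_sum_type, Amat, Bmat, Cmat,
        -Prod.mk.injEq]
    all_goals ring
  · rintro (p | i | p) (q | j | q) <;> simp [Cmat]
end

section
/- Let ε, μ > 0, let E be a finite-dimensional real normed vector space, let f, s : ℝ → E be C¹ and g : ℝ → E continuous, and suppose s'(t) = (μ/ε) f'(t) − (1/ε) s(t) + (1/ε) g(t) for all t ∈ ℝ. Assume moreover that the functions t ↦ s(t) − (μ/ε) f(t) and t ↦ (μ/ε) f(t) − g(t) are bounded on ℝ. Then for every t ∈ ℝ the integral below converges absolutely and s(t) = (μ/ε) f(t) − ∫_{−∞}^{t} (1/ε) e^{−(t−τ)/ε} ( (μ/ε) f(τ) − g(τ) ) dτ. -/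
/-!
STATEMENT 8: the memory-kernel representation of the stress: if
`s'(t) = (μ/ε) f'(t) − (1/ε) s(t) + (1/ε) g(t)` and `s − (μ/ε) f`, `(μ/ε) f − g` are
bounded, then `s(t) = (μ/ε) f(t) − ∫_{−∞}^t (1/ε) e^{−(t−τ)/ε} ((μ/ε) f(τ) − g(τ)) dτ`,
the integral converging absolutely.
-/

open MeasureTheory

open Filter Topology

/-- The exponential memory kernel is integrable on the past `(-∞, t]`. -/
theorem integrableOn_memoryKernel {ε : ℝ} (hε : 0 < ε) (t : ℝ) :
    IntegrableOn (fun τ => (1 / ε) * Real.exp (-(t - τ) / ε)) (Set.Iic t) := by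
  have h := (integrableOn_exp_mul_Iic (one_div_pos.2 hε) t).const_mul
    ((1 / ε) * Real.exp (-t / ε))
  refine h.congr (Eventually.of_forall fun τ => ?_)
  change (1 / ε) * Real.exp (-t / ε) * Real.exp (1 / ε * τ) = _
  rw [mul_assoc, ← Real.exp_add]
  congr 2
  ring

theorem tendsto_exp_neg_sub_div_atBot {ε : ℝ} (hε : 0 < ε) (t : ℝ) :
    Tendsto (fun τ => Real.exp (-(t - τ) / ε)) atBot (𝓝 0) := by
  refine Real.tendsto_exp_atBot.comp (Tendsto.atBot_div_const hε ?_)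
  simpa [sub_eq_add_neg] using tendsto_atBot_add_const_right atBot (-t) tendsto_id

theorem hasDerivAt_exp_neg_sub_div (ε t τ : ℝ) :
    HasDerivAt (fun τ => Real.exp (-(t - τ) / ε)) ((1 / ε) * Real.exp (-(t - τ) / ε)) τ := by
  have h : HasDerivAt (fun τ => -(t - τ) / ε) (1 / ε) τ := by
    simpa using (((hasDerivAt_id τ).const_sub t).neg.div_const ε)
  simpa [mul_comm] using h.exp

/-- A continuous bounded function is integrable against the memory kernel. -/
theorem integrable_memoryKernel_smul {E : Type*} [NormedAddCommGroup E] [NormedSpace ℝ E]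
    {ε M : ℝ} (hε : 0 < ε) {h : ℝ → E} (hc : Continuous h) (hM : ∀ t, ‖h t‖ ≤ M) (t : ℝ) :
    Integrable (fun τ => ((1 / ε) * Real.exp (-(t - τ) / ε)) • h τ)
      (volume.restrict (Set.Iic t)) :=
  Integrable.smul_bdd (integrableOn_memoryKernel hε t) M hc.aestronglyMeasurable
    (Eventually.of_forall hM)

/-- Variation of constants: a bounded solution of `u' = -(1/ε) (u + h)` with bounded continuous
forcing `h` is minus the exponentially weighted average of the past of `h`. -/
theorem integral_memoryKernel_smul_eq_neg {E : Type*} [NormedAddCommGroup E] [NormedSpace ℝ E]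
    [CompleteSpace E] {ε M N : ℝ} (hε : 0 < ε) {u h : ℝ → E} (hc : Continuous h)
    (hu : ∀ t, HasDerivAt u (-((1 / ε) • (u t + h t))) t)
    (hM : ∀ t, ‖u t‖ ≤ M) (hN : ∀ t, ‖h t‖ ≤ N) (t : ℝ) :
    ∫ τ in Set.Iic t, ((1 / ε) * Real.exp (-(t - τ) / ε)) • h τ = -u t := by
  have hd : ∀ τ ∈ Set.Iic t, HasDerivAt (fun τ => -(Real.exp (-(t - τ) / ε) • u τ))
      (((1 / ε) * Real.exp (-(t - τ) / ε)) • h τ) τ := fun τ _ =>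
    ((hasDerivAt_exp_neg_sub_div ε t τ).smul (hu τ)).neg.congr_deriv (by module)
  have hlim : Tendsto (fun τ => -(Real.exp (-(t - τ) / ε) • u τ)) atBot (𝓝 0) := by
    have hz := (tendsto_exp_neg_sub_div_atBot hε t).zero_smul_isBoundedUnder_le
      (isBoundedUnder_of ⟨M, hM⟩ : IsBoundedUnder (· ≤ ·) atBot (norm ∘ u))
    simpa using hz.neg
  simpa using integral_Iic_of_hasDerivAt_of_tendsto' hd
    (integrable_memoryKernel_smul hε hc hN t) hlim

/-- Variation of constants / memory representation for the linear ODE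
satisfied by the stress. -/
theorem stmt8 (ε μ : ℝ) (hε : 0 < ε) (hμ : 0 < μ)
    {E : Type*} [NormedAddCommGroup E] [NormedSpace ℝ E] [FiniteDimensional ℝ E]
    (f s : ℝ → E) (g : ℝ → E)
    (hf : ContDiff ℝ 1 f) (hs : ContDiff ℝ 1 s) (hg : Continuous g)
    (hODE : ∀ t : ℝ, deriv s t = (μ / ε) • deriv f t - (1 / ε) • s t + (1 / ε) • g t)
    (hbd1 : ∃ M : ℝ, ∀ t : ℝ, ‖s t - (μ / ε) • f t‖ ≤ M)
    (hbd2 : ∃ M : ℝ, ∀ t : ℝ, ‖(μ / ε) • f t - g t‖ ≤ M) :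
    ∀ t : ℝ,
      Integrable (fun τ => ((1 / ε) * Real.exp (-(t - τ) / ε)) •
          ((μ / ε) • f τ - g τ)) (volume.restrict (Set.Iic t)) ∧
      s t = (μ / ε) • f t -
        ∫ τ in Set.Iic t, ((1 / ε) * Real.exp (-(t - τ) / ε)) •
          ((μ / ε) • f τ - g τ) := by
  obtain ⟨M, hM⟩ := hbd1
  obtain ⟨N, hN⟩ := hbd2
  have : CompleteSpace E := FiniteDimensional.complete ℝ E
  have hc : Continuous fun τ => (μ / ε) • f τ - g τ := (hf.continuous.const_smul _).sub hg
  have hu : ∀ t, HasDerivAt (fun t => s t - (μ / ε) • f t)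
      (-((1 / ε) • ((s t - (μ / ε) • f t) + ((μ / ε) • f t - g t)))) t := fun t => by
    have hs' := (hs.differentiable one_ne_zero t).hasDerivAt
    have hf' := (hf.differentiable one_ne_zero t).hasDerivAt
    rw [hODE t] at hs'
    exact (hs'.sub (hf'.const_smul (μ / ε))).congr_deriv (by module)
  refine fun t => ⟨integrable_memoryKernel_smul hε hc hN t, ?_⟩
  rw [integral_memoryKernel_smul_eq_neg hε hc hu hM hN t]
  abel
end

section
/- Let μ, ε > 0, T' > 0, and let u : ℝ³ × (0,T') → ℝ³ and G, Θ : ℝ³ × (0,T') → Mat_{3×3}(ℝ) be such that u is C², G and Θ are C¹, and suppose (with repeated indices summed over 1,2,3, and a : ℝ³ × (0,T') → ℝ³ continuous) that ∂_t G_{iα} = ∂_α u_i and ∂_t u_i = ∂_α Θ_{iα} + μ ∂_α ∂_α u_i − ε ∂_t² u_i − ε a_i hold pointwise. Then the following identity holds pointwise on ℝ³ × (0,T'): ∂_t ( (1/2)(|u|² + |G|²) + ε u_i ∂_t u_i ) − ∂_α ( u_i Θ_{iα} + μ u_i ∂_α u_i ) + μ |∇u|² − ε |∂_t u|² = ∂_α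 u_i ( G_{iα} − Θ_{iα} ) − ε a_i u_i. -/
/-!
STATEMENT 9: the basic (unmodulated) relative energy identity: if
`∂_t G_{iα} = ∂_α u_i` and `∂_t u_i = ∂_α Θ_{iα} + μ Δu_i − ε ∂_t² u_i − ε a_i`, then
`∂_t((1/2)(|u|² + |G|²) + ε u_i ∂_t u_i) − ∂_α(u_i Θ_{iα} + μ u_i ∂_α u_i)
  + μ|∇u|² − ε|∂_t u|² = ∂_α u_i (G_{iα} − Θ_{iα}) − ε a_i u_i`.
-/

noncomputable section

/-- Physical space ℝ³. -/
abbrev X3 := EuclideanSpace ℝ (Fin 3)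

/-- 3×3 real matrices, as nested functions (with the product norm). -/
abbrev M3 := Fin 3 → Fin 3 → ℝ

/-- Spatial partial derivative `∂_α`. -/
def pd {E : Type*} [NormedAddCommGroup E] [NormedSpace ℝ E]
    (α : Fin 3) (f : X3 → E) : X3 → E :=
  fun x => fderiv ℝ f x (EuclideanSpace.single α 1)

theorem ContDiffAt.differentiableAt_deriv_of_two {g : ℝ → ℝ} {t : ℝ} (hg : ContDiffAt ℝ 2 g t) :
    DifferentiableAt ℝ (deriv g) t :=
  ((hg.fderiv_right (m := 1) (by norm_num)).differentiableAt (by norm_num)).clm_apply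
    (differentiableAt_const (1 : ℝ))

theorem ContDiff.differentiable_pd {f : X3 → ℝ} (hf : ContDiff ℝ 2 f) (α : Fin 3) :
    Differentiable ℝ (pd α f) :=
  ((hf.fderiv_right (m := 1) (by norm_num)).differentiable (by norm_num)).clm_apply
    (differentiable_const _)

theorem ContDiffOn.contDiffAt_time_slice {E : Type*} [NormedAddCommGroup E] [NormedSpace ℝ E]
    {n : WithTop ℕ∞} {T t : ℝ} {f : ℝ → X3 → E}
    (hf : ContDiffOn ℝ n (fun p : ℝ × X3 => f p.1 p.2) (Set.Ioo 0 T ×ˢ Set.univ))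
    (ht : t ∈ Set.Ioo 0 T) (x : X3) : ContDiffAt ℝ n (fun s => f s x) t :=
  (hf.contDiffAt ((isOpen_Ioo.prod isOpen_univ).mem_nhds
    (Set.mk_mem_prod ht (Set.mem_univ x)))).comp (f := fun s : ℝ => (s, x)) t
    (contDiffAt_id.prodMk contDiffAt_const)

theorem ContDiffOn.contDiff_space_slice {E : Type*} [NormedAddCommGroup E] [NormedSpace ℝ E]
    {n : WithTop ℕ∞} {T t : ℝ} {f : ℝ → X3 → E}
    (hf : ContDiffOn ℝ n (fun p : ℝ × X3 => f p.1 p.2) (Set.Ioo 0 T ×ˢ Set.univ))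
    (ht : t ∈ Set.Ioo 0 T) : ContDiff ℝ n (f t) :=
  contDiff_iff_contDiffAt.2 fun x =>
    (hf.contDiffAt ((isOpen_Ioo.prod isOpen_univ).mem_nhds
      (Set.mk_mem_prod ht (Set.mem_univ x)))).comp (f := fun y : X3 => (t, y)) x
      (contDiffAt_const.prodMk contDiffAt_id)

theorem deriv_relative_energy (ε t : ℝ) {w : ℝ → Fin 3 → ℝ} {H : ℝ → M3}
    (hw : ∀ i, ContDiffAt ℝ 2 (fun s => w s i) t)
    (hH : ∀ i α, DifferentiableAt ℝ (fun s => H s i α) t) :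
    deriv (fun s => (1 / 2) * ((∑ i, (w s i) ^ 2) + ∑ i, ∑ α, (H s i α) ^ 2)
        + ε * ∑ i, w s i * deriv (fun r => w r i) s) t
      = (∑ i, w t i * deriv (fun s => w s i) t)
        + (∑ i, ∑ α, H t i α * deriv (fun s => H s i α) t)
        + ε * ∑ i, (deriv (fun s => w s i) t ^ 2
          + w t i * deriv (fun s => deriv (fun r => w r i) s) t) := by
  have hw1 : ∀ i, HasDerivAt (fun s => w s i) (deriv (fun s => w s i) t) t :=
    fun i => ((hw i).differentiableAt (by norm_num)).hasDerivAt
  have hw2 : ∀ i, HasDerivAt (fun s => deriv (fun r => w r i) s)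
      (deriv (fun s => deriv (fun r => w r i) s) t) t :=
    fun i => (hw i).differentiableAt_deriv_of_two.hasDerivAt
  have hH1 : ∀ i α, HasDerivAt (fun s => H s i α) (deriv (fun s => H s i α) t) t :=
    fun i α => (hH i α).hasDerivAt
  have h := (((HasDerivAt.fun_sum fun i (_ : i ∈ Finset.univ) => (hw1 i).fun_pow 2).fun_add
    (HasDerivAt.fun_sum fun i (_ : i ∈ Finset.univ) =>
      HasDerivAt.fun_sum fun α (_ : α ∈ Finset.univ) => (hH1 i α).fun_pow 2)).const_mul
        (1 / 2 : ℝ)).fun_add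
    ((HasDerivAt.fun_sum fun i (_ : i ∈ Finset.univ) => (hw1 i).fun_mul (hw2 i)).const_mul ε)
  rw [h.deriv]
  simp only [Fin.sum_univ_three]
  norm_num
  ring

theorem pd_relative_flux (μ : ℝ) (α : Fin 3) (x : X3) {w : X3 → Fin 3 → ℝ} {Ψ : X3 → M3}
    (hw : ∀ i, ContDiff ℝ 2 (fun y => w y i))
    (hΨ : ∀ i, DifferentiableAt ℝ (fun y => Ψ y i α) x) :
    pd α (fun y => (∑ i, w y i * Ψ y i α) + μ * ∑ i, w y i * pd α (fun z => w z i) y) x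
      = (∑ i, (pd α (fun y => w y i) x * Ψ x i α + w x i * pd α (fun y => Ψ y i α) x))
        + μ * ∑ i, (pd α (fun y => w y i) x ^ 2
          + w x i * pd α (pd α (fun y => w y i)) x) := by
  have hw1 : ∀ i, HasFDerivAt (fun y => w y i) (fderiv ℝ (fun y => w y i) x) x :=
    fun i => ((hw i).differentiable (by norm_num) x).hasFDerivAt
  have hw2 : ∀ i, HasFDerivAt (fun y => pd α (fun z => w z i) y)
      (fderiv ℝ (pd α (fun z => w z i)) x) x :=
    fun i => ((hw i).differentiable_pd α x).hasFDerivAt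
  have h := (HasFDerivAt.fun_sum fun i (_ : i ∈ Finset.univ) =>
      (hw1 i).fun_mul (hΨ i).hasFDerivAt).fun_add
    ((HasFDerivAt.fun_sum fun i (_ : i ∈ Finset.univ) => (hw1 i).fun_mul (hw2 i)).const_mul μ)
  rw [pd, h.fderiv]
  simp only [Fin.sum_univ_three, add_apply, smul_apply, smul_eq_mul, pd]
  ring

/-- The basic relative energy identity for the damped wave structure of
the reduced relaxation system (repeated indices summed over 1,2,3). -/
theorem stmt9 (μ ε T' : ℝ) (hμ : 0 < μ) (hε : 0 < ε) (hT' : 0 < T')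
    (u : ℝ → X3 → (Fin 3 → ℝ)) (G Θ : ℝ → X3 → M3) (a : ℝ → X3 → (Fin 3 → ℝ))
    (hu : ContDiffOn ℝ 2 (fun p : ℝ × X3 => u p.1 p.2)
      ((Set.Ioo 0 T') ×ˢ (Set.univ : Set X3)))
    (hG : ContDiffOn ℝ 1 (fun p : ℝ × X3 => G p.1 p.2)
      ((Set.Ioo 0 T') ×ˢ (Set.univ : Set X3)))
    (hΘ : ContDiffOn ℝ 1 (fun p : ℝ × X3 => Θ p.1 p.2)
      ((Set.Ioo 0 T') ×ˢ (Set.univ : Set X3)))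
    (ha : ContinuousOn (fun p : ℝ × X3 => a p.1 p.2)
      ((Set.Ioo 0 T') ×ˢ (Set.univ : Set X3)))
    (hPDE1 : ∀ t ∈ Set.Ioo (0 : ℝ) T', ∀ (x : X3) (i α : Fin 3),
      deriv (fun s => G s x i α) t = pd α (fun y => u t y i) x)
    (hPDE2 : ∀ t ∈ Set.Ioo (0 : ℝ) T', ∀ (x : X3) (i : Fin 3),
      deriv (fun s => u s x i) t =
        (∑ α, pd α (fun y => Θ t y i α) x)
          + μ * (∑ α, pd α (pd α (fun y => u t y i)) x)
          - ε * deriv (fun s => deriv (fun r => u r x i) s) t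
          - ε * a t x i) :
    ∀ t ∈ Set.Ioo (0 : ℝ) T', ∀ x : X3,
      deriv (fun s =>
          (1 / 2) * ((∑ i, (u s x i) ^ 2) + ∑ i, ∑ α, (G s x i α) ^ 2)
            + ε * ∑ i, u s x i * deriv (fun r => u r x i) s) t
        - (∑ α, pd α (fun y =>
            (∑ i, u t y i * Θ t y i α)
              + μ * ∑ i, u t y i * pd α (fun z => u t z i) y) x)
        + μ * (∑ i, ∑ α, (pd α (fun y => u t y i) x) ^ 2)
        - ε * (∑ i, (deriv (fun s => u s x i) t) ^ 2)
      = (∑ i, ∑ α, pd α (fun y => u t y i) x * (G t x i α - Θ t x i α))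
          - ε * ∑ i, a t x i * u t x i := by
  intro t ht x
  have hu_time : ∀ i, ContDiffAt ℝ 2 (fun s => u s x i) t :=
    contDiffAt_pi.1 (hu.contDiffAt_time_slice ht x)
  have hG_time : ∀ i α, DifferentiableAt ℝ (fun s => G s x i α) t := fun i α =>
    (contDiffAt_pi.1 (contDiffAt_pi.1 (hG.contDiffAt_time_slice ht x) i) α).differentiableAt
      (by norm_num)
  have hu_space : ∀ i, ContDiff ℝ 2 (fun y => u t y i) :=
    contDiff_pi.1 (hu.contDiff_space_slice ht)
  have hΘ_space : ∀ i α, DifferentiableAt ℝ (fun y => Θ t y i α) x := fun i α =>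
    (contDiff_pi.1 (contDiff_pi.1 (hΘ.contDiff_space_slice ht) i) α).differentiable
      (by norm_num) x
  rw [deriv_relative_energy ε t hu_time hG_time]
  simp only [pd_relative_flux μ _ x hu_space fun i => hΘ_space i _, hPDE1 t ht x]
  have hmom : ∀ i, u t x i * deriv (fun s => u s x i) t = u t x i * _ :=
    fun i => congrArg (u t x i * ·) (hPDE2 t ht x i)
  simp only [Fin.sum_univ_three] at hmom ⊢
  linear_combination hmom 0 + hmom 1 + hmom 2
end
end

section
/- Let μ, ε > 0, λ > 1, T' > 0, let T : Mat_{3×3}(ℝ) → Mat_{3×3}(ℝ) be C², and let (F̄, v̄) and (F̂, v̂) be sufficiently smooth (say C³) fields on ℝ³ × (0,T') satisfying: ∂_t F̄_{iα} = ∂_α v̄_i, ∂_t F̂_{iα} = ∂_α v̂_i, and, writing u = v̄ − v̂, G = F̄ − F̂, Θ_{iα} = T_{iα}(F̄) − T_{iα}(F̂), the difference equation ∂_t u_i = ∂_α Θ_{iα} + μ ∂_α∂_α u_i − ε ∂_t² u_i − ε ∂_t² v̂_i (repeated indices summed). Define the relative modulated energy 𝓗 = (1/2)(|u|² + |G|²)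 + ε u_i ∂_t u_i + (1/2) ε² λ |∂_t u|² + (1/2) ε λ μ |∇u|² + ε λ (∂_α u_i) Θ_{iα}, and the flux 𝓠_α = u_i Θ_{iα} + μ u_i ∂_α u_i + ε λ μ (∂_t u_i)(∂_α u_i) + ε λ (∂_t u_i) Θ_{iα}. Then the following identity holds pointwise on ℝ³ × (0,T'): ∂_t 𝓗 − ∂_α 𝓠_α + ( μ |∇u|² − ε λ (∂_α u_i) ∇_{jβ} T_{iα}(F̄) (∂_β u_j) ) + ε (λ − 1) |∂_t u|² = (∂_α u_i)(G_{iα} − Θ_{iα}) − ε (∂_t² v̂_i) u_i − ε² λ (∂_t² v̂_i)(∂_t u_i) + ε λ (∂_α u_i) ( ∇_{jβ} T_{iα}(F̄) − ∇_{jβ} T_{iα}(F̂) ) ∂_t F̂_{jβ}. -/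
/-!
STATEMENT 11: the relative modulated energy identity
`∂_t 𝓗 − ∂_α 𝓠_α + (μ|∇u|² − ε lam ∂_α u_i ∇_{jβ}T_{iα}(F̄) ∂_β u_j) + ε(lam−1)|∂_t u|²
   = ∂_α u_i (G_{iα} − Θ_{iα}) − ε ∂_t²v̂_i u_i − ε² lam ∂_t²v̂_i ∂_t u_i
     + ε lam ∂_α u_i (∇_{jβ}T_{iα}(F̄) − ∇_{jβ}T_{iα}(F̂)) ∂_t F̂_{jβ}`,
where `u = v̄ − v̂`, `G = F̄ − F̂`, `Θ = T(F̄) − T(F̂)` (here `lam` plays the role of λ).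
The contractions `∇_{jβ}T_{iα}(F) M_{jβ}` are expressed via the Fréchet derivative of `T`
applied to the matrix `M`.
-/

noncomputable section

/-- The time derivative of a slice of a jointly differentiable field. -/
lemma hasDerivAt_slice {E : Type*} [NormedAddCommGroup E] [NormedSpace ℝ E] {f : ℝ → X3 → E}
    {t : ℝ} {x : X3} (hf : DifferentiableAt ℝ (fun p : ℝ × X3 => f p.1 p.2) (t, x)) :
    HasDerivAt (fun s => f s x) (fderiv ℝ (fun p : ℝ × X3 => f p.1 p.2) (t, x) (1, 0)) t :=
  HasFDerivAt.comp_hasDerivAt (f := fun s : ℝ => (s, x)) t hf.hasFDerivAt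
    ((hasDerivAt_id t).prodMk (hasDerivAt_const t x))

/-- The space derivative of a slice of a jointly differentiable field. -/
lemma hasFDerivAt_slice {E : Type*} [NormedAddCommGroup E] [NormedSpace ℝ E] {f : ℝ → X3 → E}
    {t : ℝ} {x : X3} (hf : DifferentiableAt ℝ (fun p : ℝ × X3 => f p.1 p.2) (t, x)) :
    HasFDerivAt (f t) ((fderiv ℝ (fun p : ℝ × X3 => f p.1 p.2) (t, x)).comp
      (ContinuousLinearMap.inr ℝ ℝ X3)) x :=
  HasFDerivAt.comp (f := fun y : X3 => (t, y)) x hf.hasFDerivAt (hasFDerivAt_prodMk_right t x)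

lemma pd_slice {E : Type*} [NormedAddCommGroup E] [NormedSpace ℝ E] {f : ℝ → X3 → E}
    {t : ℝ} {x : X3} (hf : DifferentiableAt ℝ (fun p : ℝ × X3 => f p.1 p.2) (t, x)) (α : Fin 3) :
    pd α (f t) x = fderiv ℝ (fun p : ℝ × X3 => f p.1 p.2) (t, x)
      (0, EuclideanSpace.single α 1) := by
  simp [pd, (hasFDerivAt_slice hf).fderiv]

lemma eventually_differentiableAt {E F : Type*} [NormedAddCommGroup E] [NormedSpace ℝ E]
    [NormedAddCommGroup F] [NormedSpace ℝ F] {f : E → F} {p : E} (hf : ContDiffAt ℝ 2 f p) :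
    ∀ᶠ q in nhds p, DifferentiableAt ℝ f q :=
  (hf.eventually (by simp)).mono fun _ h => h.differentiableAt (by simp)

lemma deriv_slice_eventuallyEq {E : Type*} [NormedAddCommGroup E] [NormedSpace ℝ E]
    {f : ℝ → X3 → E} {p : ℝ × X3} (hf : ContDiffAt ℝ 2 (fun p : ℝ × X3 => f p.1 p.2) p) :
    (fun q : ℝ × X3 => deriv (fun s => f s q.2) q.1) =ᶠ[nhds p]
      fun q => fderiv ℝ (fun p : ℝ × X3 => f p.1 p.2) q (1, 0) :=
  (eventually_differentiableAt hf).mono fun _ h => (hasDerivAt_slice h).deriv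

lemma pd_slice_eventuallyEq {E : Type*} [NormedAddCommGroup E] [NormedSpace ℝ E]
    {f : ℝ → X3 → E} {p : ℝ × X3} (hf : ContDiffAt ℝ 2 (fun p : ℝ × X3 => f p.1 p.2) p)
    (α : Fin 3) :
    (fun q : ℝ × X3 => pd α (f q.1) q.2) =ᶠ[nhds p]
      fun q => fderiv ℝ (fun p : ℝ × X3 => f p.1 p.2) q (0, EuclideanSpace.single α 1) :=
  (eventually_differentiableAt hf).mono fun _ h => pd_slice h α

lemma differentiableAt_fderiv {E F : Type*} [NormedAddCommGroup E] [NormedSpace ℝ E]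
    [NormedAddCommGroup F] [NormedSpace ℝ F] {f : E → F} {p : E} (hf : ContDiffAt ℝ 2 f p) :
    DifferentiableAt ℝ (fderiv ℝ f) p :=
  (hf.fderiv_right (m := 1) (by norm_num)).differentiableAt (by simp)

lemma differentiableAt_deriv_slice {E : Type*} [NormedAddCommGroup E] [NormedSpace ℝ E]
    {f : ℝ → X3 → E} {p : ℝ × X3} (hf : ContDiffAt ℝ 2 (fun p : ℝ × X3 => f p.1 p.2) p) :
    DifferentiableAt ℝ (fun q : ℝ × X3 => deriv (fun s => f s q.2) q.1) p :=
  ((differentiableAt_fderiv hf).clm_apply (differentiableAt_const _)).congr_of_eventuallyEq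
    (deriv_slice_eventuallyEq hf)

lemma differentiableAt_pd_slice {E : Type*} [NormedAddCommGroup E] [NormedSpace ℝ E]
    {f : ℝ → X3 → E} {p : ℝ × X3} (hf : ContDiffAt ℝ 2 (fun p : ℝ × X3 => f p.1 p.2) p)
    (α : Fin 3) :
    DifferentiableAt ℝ (fun q : ℝ × X3 => pd α (f q.1) q.2) p :=
  ((differentiableAt_fderiv hf).clm_apply (differentiableAt_const _)).congr_of_eventuallyEq
    (pd_slice_eventuallyEq hf α)

/-- Time and space derivatives of a `C²` field commute. -/
lemma deriv_pd_comm {E : Type*} [NormedAddCommGroup E] [NormedSpace ℝ E]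
    {f : ℝ → X3 → E} {t : ℝ} {x : X3}
    (hf : ContDiffAt ℝ 2 (fun p : ℝ × X3 => f p.1 p.2) (t, x)) (α : Fin 3) :
    deriv (fun s => pd α (f s) x) t = pd α (fun y => deriv (fun s => f s y) t) x := by
  rw [(hasDerivAt_slice (differentiableAt_pd_slice hf α)).deriv,
    pd_slice (f := fun t y => deriv (fun s => f s y) t) (differentiableAt_deriv_slice hf),
    (pd_slice_eventuallyEq hf α).fderiv_eq, (deriv_slice_eventuallyEq hf).fderiv_eq,
    fderiv_clm_apply (differentiableAt_fderiv hf) (differentiableAt_const _),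
    fderiv_clm_apply (differentiableAt_fderiv hf) (differentiableAt_const _)]
  simpa using (hf.isSymmSndFDerivAt (by simp)).eq (1, 0) (0, EuclideanSpace.single α 1)

lemma pd_sub {E : Type*} [NormedAddCommGroup E] [NormedSpace ℝ E] {f g : X3 → E} {x : X3}
    (hf : DifferentiableAt ℝ f x) (hg : DifferentiableAt ℝ g x) (α : Fin 3) :
    pd α (fun y => f y - g y) x = pd α f x - pd α g x := by
  simp [pd, fderiv_fun_sub hf hg]

/-- Product rule for the flux of the relative modulated energy. -/
lemma pd_flux {a θ p w : Fin 3 → X3 → ℝ} {x : X3} (ha : ∀ i, DifferentiableAt ℝ (a i) x)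
    (hθ : ∀ i, DifferentiableAt ℝ (θ i) x) (hp : ∀ i, DifferentiableAt ℝ (p i) x)
    (hw : ∀ i, DifferentiableAt ℝ (w i) x) (μ k m : ℝ) (α : Fin 3) :
    pd α (fun y => ∑ i, (a i y * θ i y + μ * a i y * p i y + k * w i y * p i y
        + m * w i y * θ i y)) x
      = ∑ i, (pd α (a i) x * θ i x + a i x * pd α (θ i) x
        + μ * (pd α (a i) x * p i x + a i x * pd α (p i) x)
        + k * (pd α (w i) x * p i x + w i x * pd α (p i) x)
        + m * (pd α (w i) x * θ i x + w i x * pd α (θ i) x)) := by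
  have h := HasFDerivAt.fun_sum (u := Finset.univ) fun i _ =>
    ((((ha i).hasFDerivAt.mul (hθ i).hasFDerivAt).add
      (((ha i).hasFDerivAt.const_mul μ).mul (hp i).hasFDerivAt)).add
      (((hw i).hasFDerivAt.const_mul k).mul (hp i).hasFDerivAt)).add
      (((hw i).hasFDerivAt.const_mul m).mul (hθ i).hasFDerivAt)
  have h' := congrArg (fun L => L (EuclideanSpace.single α 1)) h.fderiv
  refine Eq.trans h' ?_
  simp only [sum_apply, add_apply,
    smul_apply, smul_eq_mul, pd]
  exact Finset.sum_congr rfl fun i _ => by ring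

/-- Product rule for the relative modulated energy. -/
lemma hasDerivAt_energy {a w : Fin 3 → ℝ → ℝ} {g p θ : Fin 3 → Fin 3 → ℝ → ℝ}
    {a' w' : Fin 3 → ℝ} {g' p' θ' : Fin 3 → Fin 3 → ℝ} {t : ℝ}
    (ha : ∀ i, HasDerivAt (a i) (a' i) t) (hw : ∀ i, HasDerivAt (w i) (w' i) t)
    (hg : ∀ i α, HasDerivAt (g i α) (g' i α) t) (hp : ∀ i α, HasDerivAt (p i α) (p' i α) t)
    (hθ : ∀ i α, HasDerivAt (θ i α) (θ' i α) t) (c k l m n : ℝ) :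
    HasDerivAt (fun s => c * ((∑ i, a i s ^ 2) + ∑ i, ∑ α, g i α s ^ 2)
        + k * (∑ i, a i s * w i s) + l * (∑ i, w i s ^ 2) + m * (∑ i, ∑ α, p i α s ^ 2)
        + n * (∑ i, ∑ α, p i α s * θ i α s))
      (c * ((∑ i, 2 * a i t * a' i) + ∑ i, ∑ α, 2 * g i α t * g' i α)
        + k * (∑ i, (a' i * w i t + a i t * w' i)) + l * (∑ i, 2 * w i t * w' i)
        + m * (∑ i, ∑ α, 2 * p i α t * p' i α)
        + n * (∑ i, ∑ α, (p' i α * θ i α t + p i α t * θ' i α))) t := by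
  have sq {f : ℝ → ℝ} {f' : ℝ} (hf : HasDerivAt f f' t) :
      HasDerivAt (fun s => f s ^ 2) (2 * f t * f') t := by
    simpa using hf.fun_pow 2
  refine ((((HasDerivAt.const_mul c (HasDerivAt.add ?_ ?_)).add (HasDerivAt.const_mul k ?_)).add
    (HasDerivAt.const_mul l ?_)).add (HasDerivAt.const_mul m ?_)).add (HasDerivAt.const_mul n ?_)
  · exact HasDerivAt.fun_sum fun i _ => sq (ha i)
  · exact HasDerivAt.fun_sum fun i _ => HasDerivAt.fun_sum fun α _ => sq (hg i α)
  · exact HasDerivAt.fun_sum fun i _ => (ha i).mul (hw i)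
  · exact HasDerivAt.fun_sum fun i _ => sq (hw i)
  · exact HasDerivAt.fun_sum fun i _ => HasDerivAt.fun_sum fun α _ => sq (hp i α)
  · exact HasDerivAt.fun_sum fun i _ => HasDerivAt.fun_sum fun α _ => (hp i α).mul (hθ i α)

/-- Chain rule for the stress along a time slice of a differentiable matrix field. -/
lemma hasDerivAt_stress {T : M3 → M3} (hT : Differentiable ℝ T) {F : ℝ → X3 → M3} {t : ℝ} {x : X3}
    (hF : DifferentiableAt ℝ (fun p : ℝ × X3 => F p.1 p.2) (t, x)) (i α : Fin 3) :
    HasDerivAt (fun s => T (F s x) i α)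
      (fderiv ℝ T (F t x) (fun j β => deriv (fun s => F s x j β) t) i α) t := by
  have h := hasDerivAt_slice hF
  have hd : (fun j β => deriv (fun s => F s x j β) t)
      = fderiv ℝ (fun p : ℝ × X3 => F p.1 p.2) (t, x) (1, 0) := by
    funext j β
    exact (hasDerivAt_pi.1 (hasDerivAt_pi.1 h j) β).deriv
  rw [hd]
  exact hasDerivAt_pi.1 (hasDerivAt_pi.1
    (HasFDerivAt.comp_hasDerivAt t (hT (F t x)).hasFDerivAt h) i) α

/-- The relative modulated energy identity (repeated indices summed
over 1,2,3). -/
theorem stmt11 (μ ε lam T' : ℝ) (hμ : 0 < μ) (hε : 0 < ε) (hlam : 1 < lam)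
    (hT' : 0 < T')
    (T : M3 → M3) (hT : ContDiff ℝ 2 T)
    (Fb Fh : ℝ → X3 → M3) (vb vh : ℝ → X3 → (Fin 3 → ℝ))
    (hFb : ContDiffOn ℝ 3 (fun p : ℝ × X3 => Fb p.1 p.2)
      ((Set.Ioo 0 T') ×ˢ (Set.univ : Set X3)))
    (hFh : ContDiffOn ℝ 3 (fun p : ℝ × X3 => Fh p.1 p.2)
      ((Set.Ioo 0 T') ×ˢ (Set.univ : Set X3)))
    (hvb : ContDiffOn ℝ 3 (fun p : ℝ × X3 => vb p.1 p.2)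
      ((Set.Ioo 0 T') ×ˢ (Set.univ : Set X3)))
    (hvh : ContDiffOn ℝ 3 (fun p : ℝ × X3 => vh p.1 p.2)
      ((Set.Ioo 0 T') ×ˢ (Set.univ : Set X3)))
    -- the difference fields u = v̄ − v̂, G = F̄ − F̂, Θ = T(F̄) − T(F̂)
    (u : ℝ → X3 → (Fin 3 → ℝ)) (G Θ : ℝ → X3 → M3)
    (hu : ∀ (t : ℝ) (x : X3) (i : Fin 3), u t x i = vb t x i - vh t x i)
    (hG : ∀ (t : ℝ) (x : X3) (i α : Fin 3), G t x i α = Fb t x i α - Fh t x i α)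
    (hΘ : ∀ (t : ℝ) (x : X3) (i α : Fin 3),
      Θ t x i α = T (Fb t x) i α - T (Fh t x) i α)
    -- the kinematic equations ∂_t F̄_{iα} = ∂_α v̄_i, ∂_t F̂_{iα} = ∂_α v̂_i
    (hkinb : ∀ t ∈ Set.Ioo (0 : ℝ) T', ∀ (x : X3) (i α : Fin 3),
      deriv (fun s => Fb s x i α) t = pd α (fun y => vb t y i) x)
    (hkinh : ∀ t ∈ Set.Ioo (0 : ℝ) T', ∀ (x : X3) (i α : Fin 3),
      deriv (fun s => Fh s x i α) t = pd α (fun y => vh t y i) x)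
    -- the difference equation ∂_t u_i = ∂_α Θ_{iα} + μΔu_i − ε∂_t²u_i − ε∂_t²v̂_i
    (hdiff : ∀ t ∈ Set.Ioo (0 : ℝ) T', ∀ (x : X3) (i : Fin 3),
      deriv (fun s => u s x i) t =
        (∑ α, pd α (fun y => Θ t y i α) x)
          + μ * (∑ α, pd α (pd α (fun y => u t y i)) x)
          - ε * deriv (fun s => deriv (fun r => u r x i) s) t
          - ε * deriv (fun s => deriv (fun r => vh r x i) s) t) :
    ∀ t ∈ Set.Ioo (0 : ℝ) T', ∀ x : X3,
      -- ∂_t 𝓗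
      deriv (fun s =>
          (1 / 2) * ((∑ i, (u s x i) ^ 2) + ∑ i, ∑ α, (G s x i α) ^ 2)
            + ε * (∑ i, u s x i * deriv (fun r => u r x i) s)
            + (1 / 2) * ε ^ 2 * lam * (∑ i, (deriv (fun r => u r x i) s) ^ 2)
            + (1 / 2) * ε * lam * μ * (∑ i, ∑ α, (pd α (fun y => u s y i) x) ^ 2)
            + ε * lam * (∑ i, ∑ α, pd α (fun y => u s y i) x * Θ s x i α)) t
        -- − ∂_α 𝓠_α
        - (∑ α, pd α (fun y => ∑ i,
            (u t y i * Θ t y i α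
              + μ * u t y i * pd α (fun z => u t z i) y
              + ε * lam * μ * deriv (fun s => u s y i) t * pd α (fun z => u t z i) y
              + ε * lam * deriv (fun s => u s y i) t * Θ t y i α)) x)
        -- + (μ|∇u|² − ε lam ∂_α u_i ∇_{jβ}T_{iα}(F̄) ∂_β u_j)
        + (μ * (∑ i, ∑ α, (pd α (fun y => u t y i) x) ^ 2)
            - ε * lam * (∑ i, ∑ α, pd α (fun y => u t y i) x *
                fderiv ℝ T (Fb t x) (fun j β => pd β (fun y => u t y j) x) i α))
        -- + ε(lam − 1)|∂_t u|²
        + ε * (lam - 1) * (∑ i, (deriv (fun s => u s x i) t) ^ 2)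
      -- = 𝓡^ε
      = (∑ i, ∑ α, pd α (fun y => u t y i) x * (G t x i α - Θ t x i α))
          - ε * (∑ i, deriv (fun s => deriv (fun r => vh r x i) s) t * u t x i)
          - ε ^ 2 * lam *
              (∑ i, deriv (fun s => deriv (fun r => vh r x i) s) t *
                deriv (fun s => u s x i) t)
          + ε * lam * (∑ i, ∑ α, pd α (fun y => u t y i) x *
              (fderiv ℝ T (Fb t x) (fun j β => deriv (fun s => Fh s x j β) t) i α
                - fderiv ℝ T (Fh t x) (fun j β => deriv (fun s => Fh s x j β) t) i α)) := by
  intro t ht x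
  have hmem : (Set.Ioo 0 T') ×ˢ (Set.univ : Set X3) ∈ nhds (t, x) :=
    (isOpen_Ioo.prod isOpen_univ).mem_nhds ⟨ht, Set.mem_univ x⟩
  have cFb := hFb.contDiffAt hmem
  have cFh := hFh.contDiffAt hmem
  have cvb (i : Fin 3) : ContDiffAt ℝ 3 (fun p : ℝ × X3 => vb p.1 p.2 i) (t, x) :=
    contDiffAt_pi.1 (hvb.contDiffAt hmem) i
  have cvh (i : Fin 3) : ContDiffAt ℝ 3 (fun p : ℝ × X3 => vh p.1 p.2 i) (t, x) :=
    contDiffAt_pi.1 (hvh.contDiffAt hmem) i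
  have cu (i : Fin 3) : ContDiffAt ℝ 2 (fun p : ℝ × X3 => u p.1 p.2 i) (t, x) := by
    simp only [hu]
    exact ((cvb i).sub (cvh i)).of_le (by norm_num)
  have du (i : Fin 3) := (cu i).differentiableAt (by simp)
  have dFb := cFb.differentiableAt (by simp)
  have dFh := cFh.differentiableAt (by simp)
  have dT : Differentiable ℝ T := hT.differentiable (by simp)
  have dTF {F : ℝ → X3 → M3} (hF : DifferentiableAt ℝ (fun p : ℝ × X3 => F p.1 p.2) (t, x))
      (i α : Fin 3) : DifferentiableAt ℝ (fun p : ℝ × X3 => T (F p.1 p.2) i α) (t, x) :=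
    differentiableAt_pi.1 (differentiableAt_pi.1 ((dT _).comp (t, x) hF) i) α
  have dΘ (i α : Fin 3) : DifferentiableAt ℝ (fun p : ℝ × X3 => Θ p.1 p.2 i α) (t, x) := by
    simp only [hΘ]
    exact (dTF dFb i α).sub (dTF dFh i α)
  have hpu (i α : Fin 3) : pd α (fun y => u t y i) x
      = pd α (fun y => vb t y i) x - pd α (fun y => vh t y i) x := by
    simp only [hu]
    exact pd_sub
      (hasFDerivAt_slice (f := fun t y => vb t y i)
        ((cvb i).differentiableAt (by simp))).differentiableAt
      (hasFDerivAt_slice (f := fun t y => vh t y i)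
        ((cvh i).differentiableAt (by simp))).differentiableAt α
  have hF' {F : ℝ → X3 → M3} (hF : DifferentiableAt ℝ (fun p : ℝ × X3 => F p.1 p.2) (t, x))
      (i α : Fin 3) : HasDerivAt (fun s => F s x i α) (deriv (fun s => F s x i α) t) t :=
    (hasDerivAt_pi.1 (hasDerivAt_pi.1 (hasDerivAt_slice hF) i)
      α).differentiableAt.hasDerivAt
  have hG' (i α : Fin 3) :
      HasDerivAt (fun s => G s x i α) (pd α (fun y => u t y i) x) t := by
    rw [hpu, ← hkinb t ht, ← hkinh t ht]
    simp only [hG]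
    exact (hF' dFb i α).sub (hF' dFh i α)
  have hΘ' (i α : Fin 3) : HasDerivAt (fun s => Θ s x i α)
      (fderiv ℝ T (Fb t x) (fun j β => deriv (fun s => Fb s x j β) t) i α
        - fderiv ℝ T (Fh t x) (fun j β => deriv (fun s => Fh s x j β) t) i α) t := by
    simp only [hΘ]
    exact (hasDerivAt_stress dT dFb i α).sub (hasDerivAt_stress dT dFh i α)
  have hp' (i α : Fin 3) : HasDerivAt (fun s => pd α (fun y => u s y i) x)
      (pd α (fun y => deriv (fun s => u s y i) t) x) t := by
    rw [← deriv_pd_comm (f := fun s y => u s y i) (cu i) α]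
    exact (hasDerivAt_slice (f := fun s y => pd α (fun z => u s z i) y)
      (differentiableAt_pd_slice (f := fun s y => u s y i) (cu i) α)).differentiableAt.hasDerivAt
  have hu' (i : Fin 3) : HasDerivAt (fun s => u s x i) (deriv (fun s => u s x i) t) t :=
    (hasDerivAt_slice (f := fun s y => u s y i) (du i)).differentiableAt.hasDerivAt
  have hw' (i : Fin 3) : HasDerivAt (fun s => deriv (fun r => u r x i) s)
      (deriv (fun s => deriv (fun r => u r x i) s) t) t :=
    (hasDerivAt_slice (f := fun s y => deriv (fun r => u r y i) s)
      (differentiableAt_deriv_slice (f := fun s y => u s y i)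
        (cu i))).differentiableAt.hasDerivAt
  have hflux (α : Fin 3) := pd_flux (x := x) (a := fun i y => u t y i) (θ := fun i y => Θ t y i α)
    (p := fun i y => pd α (fun z => u t z i) y) (w := fun i y => deriv (fun s => u s y i) t)
    (fun i => (hasFDerivAt_slice (f := fun s y => u s y i) (du i)).differentiableAt)
    (fun i => (hasFDerivAt_slice (f := fun s y => Θ s y i α) (dΘ i α)).differentiableAt)
    (fun i => (hasFDerivAt_slice (f := fun s y => pd α (fun z => u s z i) y)
      (differentiableAt_pd_slice (f := fun s y => u s y i) (cu i) α)).differentiableAt)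
    (fun i => (hasFDerivAt_slice (f := fun s y => deriv (fun r => u r y i) s)
      (differentiableAt_deriv_slice (f := fun s y => u s y i) (cu i))).differentiableAt)
    μ (ε * lam * μ) (ε * lam) α
  have hstress (i α : Fin 3) :
      fderiv ℝ T (Fb t x) (fun j β => pd β (fun y => u t y j) x) i α
        = fderiv ℝ T (Fb t x) (fun j β => deriv (fun s => Fb s x j β) t) i α
          - fderiv ℝ T (Fb t x) (fun j β => deriv (fun s => Fh s x j β) t) i α := by
    have h : (fun j β => pd β (fun y => u t y j) x)
        = (fun j β => deriv (fun s => Fb s x j β) t)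
          - (fun j β => deriv (fun s => Fh s x j β) t) := by
      funext j β
      simp only [Pi.sub_apply, hpu, hkinb t ht, hkinh t ht]
    rw [h, map_sub]
    rfl
  rw [(hasDerivAt_energy hu' hw' hG' hp' hΘ' (1 / 2) ε ((1 / 2) * ε ^ 2 * lam)
    ((1 / 2) * ε * lam * μ) (ε * lam)).deriv]
  simp only [hflux, hstress]
  have e (i : Fin 3) := hdiff t ht x i
  change ∀ i, _ = _ + μ * (∑ α, pd α (fun y => pd α (fun y => u t y i) y) x) - _ - _ at e
  simp only [Fin.sum_univ_three] at e ⊢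
  linear_combination (u t x 0 + ε * lam * deriv (fun s => u s x 0) t) * e 0
    + (u t x 1 + ε * lam * deriv (fun s => u s x 1) t) * e 1
    + (u t x 2 + ε * lam * deriv (fun s => u s x 2) t) * e 2
end
end

section
/- Let μ > 0 and Γ > 0. There exist λ > 1, ε₀ > 0 and constants C₂ ≥ C₃ > 0, depending only on μ and Γ, with the following property. For every ε ∈ (0, ε₀] and all u, w ∈ ℝ³, G, Θ, P ∈ Mat_{3×3}(ℝ) with |Θ| ≤ Γ |G|, setting 𝓗 = (1/2)(|u|² + |G|²) + ε u·w + (1/2) ε² λ |w|² + (1/2) ε λ μ |P|² + ε λ P:Θ and h = |u|² + |G|² + ε² |w|² + ε |P|², one has C₃ h ≤ 𝓗 ≤ C₂ h. In particular the relative modulated energy density 𝓗 (with u = v̄ − v̂, w = ∂_t(v̄ − v̂), G = F̄ − F̂, P = ∇(v̄ − v̂), Θ = T(F̄) − T(F̂)) is, for ε sufficiently small and λ properly chosen, equivalent to the quantity |v̄ − v̂|² + |F̄ − F̂|² + ε² |∂_t(v̄ − v̂)|² + ε |∇(v̄ − v̂)|². -/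
/-!
STATEMENT 12: coercivity and boundedness of the relative modulated energy density:
for `μ, Γ > 0` there are `lam > 1`, `ε₀ > 0` and constants `C₂ ≥ C₃ > 0` (depending only
on `μ` and `Γ`) such that for `0 < ε ≤ ε₀` and all `u, w ∈ ℝ³`, `G, Θ, P ∈ Mat_{3×3}(ℝ)`
with `|Θ| ≤ Γ|G|`,
`C₃ h ≤ 𝓗 ≤ C₂ h` where
`𝓗 = (1/2)(|u|² + |G|²) + ε u·w + (1/2)ε² lam |w|² + (1/2)ε lam μ |P|² + ε lam P:Θ` and
`h = |u|² + |G|² + ε²|w|² + ε|P|²`.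
-/

noncomputable section

/-- Squared Frobenius norm. -/
def frobSq (A : M3) : ℝ := ∑ i, ∑ α, (A i α) ^ 2

/-- Frobenius inner product `A:B`. -/
def frobIP (A B : M3) : ℝ := ∑ i, ∑ α, A i α * B i α

/-- The relative modulated energy density. -/
def Hrm (μ ε lam : ℝ) (u w : Fin 3 → ℝ) (G Θ P : M3) : ℝ :=
  (1 / 2) * ((∑ i, (u i) ^ 2) + frobSq G) + ε * (∑ i, u i * w i)
    + (1 / 2) * ε ^ 2 * lam * (∑ i, (w i) ^ 2)
    + (1 / 2) * ε * lam * μ * frobSq P + ε * lam * frobIP P Θ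

/-- Weighted Young inequality for finite sums. -/
theorem abs_sum_mul_le_weighted {ι : Type*} (s : Finset ι) (x y : ι → ℝ) {t : ℝ} (ht : 0 < t) :
    |∑ i ∈ s, x i * y i| ≤ t / 2 * (∑ i ∈ s, x i ^ 2) + 1 / (2 * t) * ∑ i ∈ s, y i ^ 2 := by
  refine (Finset.abs_sum_le_sum_abs _ _).trans ?_
  rw [Finset.mul_sum, Finset.mul_sum, ← Finset.sum_add_distrib]
  refine Finset.sum_le_sum fun i _ => ?_
  have key : ∀ a b : ℝ, t / 2 * a ^ 2 + 1 / (2 * t) * b ^ 2 - a * b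
      = 1 / (2 * t) * (t * a - b) ^ 2 := fun a b => by field_simp; ring
  have h := key |x i| |y i|
  rw [sq_abs, sq_abs, ← abs_mul] at h
  have : 0 ≤ 1 / (2 * t) * (t * |x i| - |y i|) ^ 2 := by positivity
  linarith

theorem frobSq_nonneg (A : M3) : 0 ≤ frobSq A := by
  unfold frobSq; positivity

theorem abs_frobIP_le_weighted (A B : M3) {t : ℝ} (ht : 0 < t) :
    |frobIP A B| ≤ t / 2 * frobSq A + 1 / (2 * t) * frobSq B := by
  have h := abs_sum_mul_le_weighted (Finset.univ : Finset (Fin 3 × Fin 3))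
    (fun q => A q.1 q.2) (fun q => B q.1 q.2) ht
  simpa only [frobIP, frobSq, Fintype.sum_prod_type] using h

/-- Equivalence of the relative modulated energy density with
`h = |u|² + |G|² + ε²|w|² + ε|P|²`, for `ε` small and `lam > 1` properly chosen. -/
theorem stmt12 (μ Γ : ℝ) (hμ : 0 < μ) (hΓ : 0 < Γ) :
    ∃ lam : ℝ, 1 < lam ∧ ∃ ε₀ : ℝ, 0 < ε₀ ∧ ∃ C₂ C₃ : ℝ, C₃ ≤ C₂ ∧ 0 < C₃ ∧
      ∀ ε : ℝ, 0 < ε → ε ≤ ε₀ →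
        ∀ (u w : Fin 3 → ℝ) (G Θ P : M3),
          Real.sqrt (frobSq Θ) ≤ Γ * Real.sqrt (frobSq G) →
          C₃ * ((∑ i, (u i) ^ 2) + frobSq G + ε ^ 2 * (∑ i, (w i) ^ 2) + ε * frobSq P)
              ≤ Hrm μ ε lam u w G Θ P ∧
            Hrm μ ε lam u w G Θ P ≤
              C₂ * ((∑ i, (u i) ^ 2) + frobSq G + ε ^ 2 * (∑ i, (w i) ^ 2)
                + ε * frobSq P) := by
  refine ⟨2, by norm_num, μ / (8 * Γ ^ 2), by positivity, 2 + 3 * μ / 2, min (1 / 6) (μ / 2),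
    ?_, by positivity, ?_⟩
  · linarith [min_le_left (1 / 6) (μ / 2)]
  intro ε hε hεle u w G Θ P hΘ
  have hG := frobSq_nonneg G
  have hP := frobSq_nonneg P
  have hΘsq : frobSq Θ ≤ Γ ^ 2 * frobSq G := by
    have h := pow_le_pow_left₀ (Real.sqrt_nonneg _) hΘ 2
    rwa [mul_pow, Real.sq_sqrt (frobSq_nonneg Θ), Real.sq_sqrt hG] at h
  have hU : 0 ≤ ∑ i, u i ^ 2 := by positivity
  have hW : 0 ≤ ε ^ 2 * ∑ i, w i ^ 2 := by positivity
  have hPε : 0 ≤ ε * frobSq P := by positivity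
  have huw : |ε * ∑ i, u i * w i| ≤
      1 / 3 * (∑ i, u i ^ 2) + 3 / 4 * (ε ^ 2 * ∑ i, w i ^ 2) := by
    have h := abs_sum_mul_le_weighted Finset.univ u (fun i => ε * w i)
      (show (0 : ℝ) < 2 / 3 by norm_num)
    simp only [mul_pow, mul_left_comm _ ε, ← Finset.mul_sum] at h
    norm_num at h ⊢
    linarith
  have hPΘ : |ε * 2 * frobIP P Θ| ≤ μ / 2 * (ε * frobSq P) + 1 / 4 * frobSq G := by
    have h := abs_frobIP_le_weighted P Θ (half_pos hμ)
    have hsmall : ε * Γ ^ 2 * 8 ≤ μ := by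
      rw [le_div_iff₀ (by positivity)] at hεle
      linarith
    have hΘG : 2 * ε / μ * frobSq Θ ≤ 1 / 4 * frobSq G := by
      calc 2 * ε / μ * frobSq Θ ≤ 2 * ε / μ * (Γ ^ 2 * frobSq G) := by gcongr
        _ = ε * Γ ^ 2 * 8 / μ * (1 / 4 * frobSq G) := by ring
        _ ≤ 1 * (1 / 4 * frobSq G) := by
          gcongr
          exact (div_le_one hμ).2 hsmall
        _ = 1 / 4 * frobSq G := one_mul _
    rw [abs_mul, abs_of_pos (by positivity : 0 < ε * 2)]
    calc ε * 2 * |frobIP P Θ|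
        ≤ ε * 2 * (μ / 2 / 2 * frobSq P + 1 / (2 * (μ / 2)) * frobSq Θ) := by gcongr
      _ = μ / 2 * (ε * frobSq P) + 2 * ε / μ * frobSq Θ := by field_simp
      _ ≤ _ := by gcongr
  obtain ⟨huw₁, huw₂⟩ := abs_le.1 huw
  obtain ⟨hPΘ₁, hPΘ₂⟩ := abs_le.1 hPΘ
  unfold Hrm
  constructor
  · have hl := min_le_left (1 / 6) (μ / 2)
    have hr := min_le_right (1 / 6) (μ / 2)
    linarith [mul_le_mul_of_nonneg_right hl hU, mul_le_mul_of_nonneg_right hl hG,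
      mul_le_mul_of_nonneg_right hl hW, mul_le_mul_of_nonneg_right hr hPε]
  · linarith [mul_nonneg hμ.le hU, mul_nonneg hμ.le hG, mul_nonneg hμ.le hW]
end
end
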